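/- Let κ : ℝ² → ℝ be a smooth solution of the KdV equation ∂ₜκ + ∂ₛ³κ − 6κ∂ₛκ = 0 and fix λ ∈ ℝ. Then there exists a smooth map E : ℝ² → M₂(ℝ) with det E(s,t) = 1 for all (s,t), satisfying ∂ₛE = E·𝒦_λ and ∂ₜE = E·𝒫_λ everywhere (an extended frame of κ with spectral parameter λ). -/

import Mathlib

noncomputable section

open Matrix

attribute [local instance] Matrix.normedAddCommGroup Matrix.normedSpace

/-- The space of 2×2 real matrices. -/
abbrev M2 : Type := Matrix (Fin 2) (Fin 2) ℝ

/-- Partial derivative with respect to the first variable `s` of a real-valued function. -/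
def pdS (f : ℝ → ℝ → ℝ) (s t : ℝ) : ℝ := deriv (fun x => f x t) s
/-- Partial derivative with respect to the second variable `t` of a real-valued function. -/
def pdT (f : ℝ → ℝ → ℝ) (s t : ℝ) : ℝ := deriv (fun y => f s y) t
/-- Partial derivative with respect to `s` of a matrix-valued function. -/
def pdSM (f : ℝ → ℝ → M2) (s t : ℝ) : M2 := deriv (fun x => f x t) s
/-- Partial derivative with respect to `t` of a matrix-valued function. -/
def pdTM (f : ℝ → ℝ → M2) (s t : ℝ) : M2 := deriv (fun y => f s y) t

/-- The matrix `𝒦_λ = [[0, κ+λ],[1, 0]]` of the Lax pair. -/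
def KLax (κ : ℝ → ℝ → ℝ) (l : ℝ) (s t : ℝ) : M2 := !![0, κ s t + l; 1, 0]

/-- The matrix `𝒫_λ = [[−∂ₛκ, −∂ₛ²κ + 2κ² − 2λκ − 4λ²],[2κ − 4λ, ∂ₛκ]]` of the Lax pair. -/
def PLax (κ : ℝ → ℝ → ℝ) (l : ℝ) (s t : ℝ) : M2 :=
  !![-(pdS κ s t), -(pdS (pdS κ) s t) + 2 * (κ s t) ^ 2 - 2 * l * κ s t - 4 * l ^ 2;
     2 * κ s t - 4 * l, pdS κ s t]

open Set Filter Topology MeasureTheory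

section LinearODE

variable {V : Type*} [NormedAddCommGroup V] [NormedSpace ℝ V]

/-- The terms of the Picard series solving `∂ₛ y = L(s,t) y`, `y(0,t) = a(t)`. -/
def picardTerm (L : ℝ → ℝ → V →L[ℝ] V) (a : ℝ → V) : ℕ → ℝ → ℝ → V
  | 0, _, t => a t
  | n + 1, s, t => ∫ x in (0 : ℝ)..s, L x t (picardTerm L a n x t)

variable {L : ℝ → ℝ → V →L[ℝ] V} {a : ℝ → V}

lemma continuous_picardTerm (hL : Continuous fun p : ℝ × ℝ => L p.1 p.2) (ha : Continuous a)
    (n : ℕ) : Continuous fun p : ℝ × ℝ => picardTerm L a n p.1 p.2 := by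
  induction n with
  | zero => exact ha.comp continuous_snd
  | succ n ih =>
    refine intervalIntegral.continuous_parametric_intervalIntegral_of_continuous
      (f := fun (p : ℝ × ℝ) x => L x p.2 (picardTerm L a n x p.2)) ?_ continuous_fst
    have hswap : Continuous fun q : (ℝ × ℝ) × ℝ => (q.2, q.1.2) := by fun_prop
    exact (hL.comp hswap).clm_apply (ih.comp hswap)

lemma hasDerivAt_picardTerm_succ [CompleteSpace V]
    (hL : Continuous fun p : ℝ × ℝ => L p.1 p.2) (ha : Continuous a) (n : ℕ) (s t : ℝ) :
    HasDerivAt (fun x => picardTerm L a (n + 1) x t) (L s t (picardTerm L a n s t)) s := by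
  have hpair : Continuous fun x : ℝ => (x, t) := by fun_prop
  have hc : Continuous fun x => L x t (picardTerm L a n x t) :=
    (hL.comp hpair).clm_apply ((continuous_picardTerm hL ha n).comp hpair)
  exact intervalIntegral.integral_hasDerivAt_right (hc.intervalIntegrable _ _)
    hc.aestronglyMeasurable.stronglyMeasurableAtFilter hc.continuousAt

lemma norm_picardTerm_le {C M r t : ℝ} (hC : ∀ s, |s| ≤ r → ‖L s t‖ ≤ C) (hM : ‖a t‖ ≤ M)
    (n : ℕ) {s : ℝ} (hs : |s| ≤ r) :
    ‖picardTerm L a n s t‖ ≤ M * ((C * |s|) ^ n / n.factorial) := by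
  induction n generalizing s with
  | zero => simpa [picardTerm] using hM
  | succ n ih =>
    have hmem : ∀ x ∈ uIoc 0 s, |x| ≤ r := fun x hx => by
      have : |x - 0| ≤ |s - 0| := abs_sub_left_of_mem_uIcc (uIoc_subset_uIcc hx)
      simpa using this.trans (by simpa using hs)
    calc ‖picardTerm L a (n + 1) s t‖
        ≤ ∫ x in uIoc 0 s, M * C ^ (n + 1) / n.factorial * |x - 0| ^ n := by
          rw [picardTerm, intervalIntegral.norm_intervalIntegral_eq]
          refine norm_integral_le_of_norm_le (Continuous.integrableOn_uIoc (by fun_prop)) ?_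
          refine (ae_restrict_mem measurableSet_uIoc).mono fun x hx => ?_
          calc ‖L x t (picardTerm L a n x t)‖
              ≤ C * (M * ((C * |x|) ^ n / n.factorial)) :=
                (L x t).le_of_opNorm_le_of_le (hC x (hmem x hx)) (ih (hmem x hx))
            _ = _ := by rw [sub_zero]; ring
      _ = M * ((C * |s|) ^ (n + 1) / (n + 1).factorial) := by
          rw [integral_const_mul, integral_pow_abs_sub_uIoc, sub_zero, Nat.factorial_succ]
          push_cast
          rw [mul_pow]
          field_simp

/-- A linear differential equation depending continuously on a parameter, with a continuous
initial value, has a global solution that is jointly continuous. -/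
theorem exists_linearODE_solution [CompleteSpace V]
    (hL : Continuous fun p : ℝ × ℝ => L p.1 p.2) (ha : Continuous a) :
    ∃ y : ℝ → ℝ → V, (Continuous fun p : ℝ × ℝ => y p.1 p.2) ∧ (∀ t, y 0 t = a t) ∧
      ∀ s t, HasDerivAt (fun x => y x t) (L s t (y s t)) s := by
  have hbound : ∀ r : ℝ, ∃ C M : ℝ, 0 ≤ C ∧ 0 ≤ M ∧ ∀ s t, |s| ≤ r → |t| ≤ r →
      ‖L s t‖ ≤ C ∧ ‖a t‖ ≤ M := by
    intro r
    have hK : IsCompact (Icc (-r) r ×ˢ Icc (-r) r) := isCompact_Icc.prod isCompact_Icc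
    obtain ⟨C, hC⟩ := hK.exists_bound_of_continuousOn hL.continuousOn
    obtain ⟨M, hM⟩ := (isCompact_Icc (a := -r) (b := r)).exists_bound_of_continuousOn
      ha.continuousOn
    refine ⟨max C 0, max M 0, le_max_right _ _, le_max_right _ _, fun s t hs ht => ⟨?_, ?_⟩⟩
    · exact (hC (s, t) ⟨abs_le.1 hs, abs_le.1 ht⟩).trans (le_max_left _ _)
    · exact (hM t (abs_le.1 ht)).trans (le_max_left _ _)
  have hterm : ∀ r : ℝ, ∃ C M : ℝ, ∀ n s t, |s| ≤ r → |t| ≤ r →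
      ‖L s t‖ ≤ C ∧ ‖picardTerm L a n s t‖ ≤ M * ((C * r) ^ n / n.factorial) := by
    intro r
    obtain ⟨C, M, hC0, hM0, h⟩ := hbound r
    refine ⟨C, M, fun n s t hs ht => ⟨(h s t hs ht).1, ?_⟩⟩
    refine (norm_picardTerm_le (fun x hx => (h x t hx ht).1) (h s t hs ht).2 n hs).trans ?_
    gcongr
  have hsum : ∀ C M r : ℝ, Summable fun n : ℕ => M * ((C * r) ^ n / n.factorial) :=
    fun C M r => (Real.summable_pow_div_factorial _).mul_left M
  have hsummable : ∀ s t, Summable fun n => picardTerm L a n s t := by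
    intro s t
    obtain ⟨C, M, h⟩ := hterm (max |s| |t|)
    exact .of_norm_bounded (hsum C M _) fun n => (h n s t (le_max_left _ _) (le_max_right _ _)).2
  refine ⟨fun s t => ∑' n, picardTerm L a n s t, ?_, fun t => ?_, fun s t => ?_⟩
  · rw [continuous_iff_continuousAt]
    intro p
    obtain ⟨C, M, h⟩ := hterm (‖p‖ + 1)
    have hp : Metric.ball (0 : ℝ × ℝ) (‖p‖ + 1) ∈ 𝓝 p :=
      Metric.isOpen_ball.mem_nhds (by simp)
    refine ContinuousOn.continuousAt (continuousOn_tsum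
      (fun n => (continuous_picardTerm hL ha n).continuousOn) (hsum C M (‖p‖ + 1)) ?_) hp
    intro n q hq
    have hq' : ‖q‖ ≤ ‖p‖ + 1 := (mem_ball_zero_iff.1 hq).le
    exact (h n q.1 q.2 ((norm_fst_le q).trans hq') ((norm_snd_le q).trans hq')).2
  · refine (tsum_eq_single 0 fun n hn => ?_).trans rfl
    obtain ⟨m, rfl⟩ := Nat.exists_eq_succ_of_ne_zero hn
    simp [picardTerm]
  · obtain ⟨C, M, h⟩ := hterm (max |s| |t| + 1)
    have hs : |s| < max |s| |t| + 1 := (le_max_left _ _).trans_lt (lt_add_one _)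
    have ht : |t| ≤ max |s| |t| + 1 := (le_max_right _ _).trans (lt_add_one _).le
    set r := max |s| |t| + 1
    have key := hasDerivAt_tsum_of_isPreconnected
      (g := fun n x => picardTerm L a (n + 1) x t) (g' := fun n x => L x t (picardTerm L a n x t))
      (u := fun n : ℕ => C * (M * ((C * r) ^ n / n.factorial)))
      ((hsum C M r).mul_left C) Metric.isOpen_ball (convex_ball (0 : ℝ) r).isPreconnected
      (fun n x _ => hasDerivAt_picardTerm_succ hL ha n x t)
      (fun n x hx => by
        have hx' : |x| ≤ r := (mem_ball_zero_iff.1 hx).le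
        exact (L x t).le_of_opNorm_le_of_le (h n x t hx' ht).1 (h n x t hx' ht).2)
      (mem_ball_zero_iff.2 hs) ((summable_nat_add_iff 1).2 (hsummable s t))
      (mem_ball_zero_iff.2 hs)
    rw [← (L s t).map_tsum (hsummable s t)] at key
    refine (key.const_add (a t)).congr_of_eventuallyEq (Eventually.of_forall fun x => ?_)
    exact (hsummable x t).tsum_eq_zero_add

theorem linearODE_solution_unique {A : ℝ → V →L[ℝ] V} (hA : Continuous A) {y z : ℝ → V}
    (hy : ∀ s, HasDerivAt y (A s (y s)) s) (hz : ∀ s, HasDerivAt z (A s (z s)) s)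
    (h0 : y 0 = z 0) (s : ℝ) : y s = z s := by
  obtain ⟨C, hC⟩ := (isCompact_Icc (a := -(|s| + 1)) (b := |s| + 1)).exists_bound_of_continuousOn
    hA.continuousOn
  have hs := abs_lt.1 (lt_add_one |s|)
  have hpos : 0 < |s| + 1 := by positivity
  refine ODE_solution_unique_of_mem_Ioo (v := fun s x => A s x) (s := fun _ => univ)
    (K := C.toNNReal) (a := -(|s| + 1)) (b := |s| + 1) (t₀ := 0) (fun x hx => ?_)
    ⟨neg_lt_zero.2 hpos, hpos⟩ (fun x _ => ⟨hy x, mem_univ _⟩) (fun x _ => ⟨hz x, mem_univ _⟩)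
    h0 hs
  refine ((A x).lipschitz.weaken ?_).lipschitzOnWith
  rw [← NNReal.coe_le_coe, coe_nnnorm]
  exact (hC x (Ioo_subset_Icc_self hx)).trans (Real.le_coe_toNNReal C)

end LinearODE

section ZeroCurvature

variable {V : Type*} [NormedAddCommGroup V] [NormedSpace ℝ V]

/-- Hadamard's lemma with a parameter: the difference quotient of a function whose partial
derivative is continuous extends continuously to the diagonal. -/
lemma exists_continuous_hadamard_quotient [CompleteSpace V] {f f' : ℝ → ℝ → V}
    (hf : ∀ s t, HasDerivAt (f s) (f' s t) t) (hf' : Continuous fun p : ℝ × ℝ => f' p.1 p.2)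
    (t₀ : ℝ) :
    ∃ q : ℝ → ℝ → V, (Continuous fun p : ℝ × ℝ => q p.1 p.2) ∧
      (∀ s, q s t₀ = f' s t₀) ∧ ∀ s t, (t - t₀) • q s t = f s t - f s t₀ := by
  refine ⟨fun s t => ∫ x in (0 : ℝ)..1, f' s (t₀ + x * (t - t₀)), ?_, fun s => by simp,
    fun s t => ?_⟩
  · refine intervalIntegral.continuous_parametric_intervalIntegral_of_continuous'
      (f := fun (p : ℝ × ℝ) x => f' p.1 (t₀ + x * (p.2 - t₀))) ?_ 0 1
    exact hf'.comp (f := fun q : (ℝ × ℝ) × ℝ => (q.1.1, t₀ + q.2 * (q.1.2 - t₀))) (by fun_prop)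
  · have hline : ∀ x, HasDerivAt (fun x : ℝ => t₀ + x * (t - t₀)) (t - t₀) x := fun x => by
      simpa using ((hasDerivAt_id x).mul_const (t - t₀)).const_add t₀
    have hc : Continuous fun x : ℝ => (t - t₀) • f' s (t₀ + x * (t - t₀)) :=
      (hf'.comp (f := fun x : ℝ => (s, t₀ + x * (t - t₀))) (by fun_prop)).const_smul _
    rw [← intervalIntegral.integral_smul, intervalIntegral.integral_eq_sub_of_hasDerivAt
      (fun x _ => (hf s _).scomp x (hline x)) (hc.intervalIntegrable _ _)]
    simp

lemma hasDerivAt_of_sub_eq_smul {f r : ℝ → V} {t₀ : ℝ} (hr : ContinuousAt r t₀)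
    (h : ∀ t, f t - f t₀ = (t - t₀) • r t) : HasDerivAt f (r t₀) t₀ := by
  rw [hasDerivAt_iff_tendsto_slope]
  refine (hr.tendsto.mono_left nhdsWithin_le_nhds).congr' ?_
  filter_upwards [self_mem_nhdsWithin] with t ht
  rw [slope_def_module, h t, inv_smul_smul₀ (sub_ne_zero.2 ht)]

lemma continuous_clm_prod {X F G : Type*} [TopologicalSpace X] [NormedAddCommGroup F]
    [NormedSpace ℝ F] [NormedAddCommGroup G] [NormedSpace ℝ G] {f : X → V →L[ℝ] F}
    {g : X → V →L[ℝ] G} (hf : Continuous f) (hg : Continuous g) :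
    Continuous fun x => (f x).prod (g x) :=
  (ContinuousLinearMap.prodₗᵢ (𝕜 := ℝ) (E := V) (F := F) (G := G) ℝ).continuous.comp
    (hf.prodMk hg)

variable {K Kt P Ps : ℝ → ℝ → V →L[ℝ] V}

lemma contDiff_of_partial_linear (hK : ContDiff ℝ (⊤ : ℕ∞) fun p : ℝ × ℝ => K p.1 p.2)
    (hP : ContDiff ℝ (⊤ : ℕ∞) fun p : ℝ × ℝ => P p.1 p.2) {y : ℝ → ℝ → V}
    (hyc : Continuous fun p : ℝ × ℝ => y p.1 p.2)
    (hys : ∀ s t, HasDerivAt (fun x => y x t) (K s t (y s t)) s)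
    (hyt : ∀ s t, HasDerivAt (y s) (P s t (y s t)) t) :
    ContDiff ℝ (⊤ : ℕ∞) fun p : ℝ × ℝ => y p.1 p.2 := by
  have hd : ∀ p : ℝ × ℝ, HasFDerivAt (fun p : ℝ × ℝ => y p.1 p.2)
      ((ContinuousLinearMap.toSpanSingleton ℝ (K p.1 p.2 (y p.1 p.2))).coprod
        (ContinuousLinearMap.toSpanSingleton ℝ (P p.1 p.2 (y p.1 p.2)))) p := fun p =>
    (hasStrictFDerivAt_uncurry_coprod (f := y)
      (f₁ := fun s t => ContinuousLinearMap.toSpanSingleton ℝ (K s t (y s t)))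
      (f₂ := fun s t => ContinuousLinearMap.toSpanSingleton ℝ (P s t (y s t)))
      (Eventually.of_forall fun v => (hys v.1 v.2).hasFDerivAt)
      (Eventually.of_forall fun v => (hyt v.1 v.2).hasFDerivAt)
      ((ContinuousLinearMap.toSpanSingletonCLE (𝕜 := ℝ) (E := V)).continuous.comp
        (hK.continuous.clm_apply hyc)).continuousAt
      ((ContinuousLinearMap.toSpanSingletonCLE (𝕜 := ℝ) (E := V)).continuous.comp
        (hP.continuous.clm_apply hyc)).continuousAt).hasFDerivAt
  refine contDiff_infty.2 fun n => ?_
  induction n with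
  | zero => exact contDiff_zero.2 hyc
  | succ n ih =>
    have hn : ((n : ℕ∞) : WithTop ℕ∞) ≤ ((⊤ : ℕ∞) : WithTop ℕ∞) := by exact_mod_cast le_top
    refine contDiff_succ_iff_hasFDerivAt.2 ⟨_, ?_, hd⟩
    have h₁ := (ContinuousLinearMap.toSpanSingletonCLE (𝕜 := ℝ) (E := V)).contDiff.comp
      ((hK.of_le hn).clm_apply ih)
    have h₂ := (ContinuousLinearMap.toSpanSingletonCLE (𝕜 := ℝ) (E := V)).contDiff.comp
      ((hP.of_le hn).clm_apply ih)
    simp only [← ContinuousLinearMap.comp_fst_add_comp_snd]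
    exact (h₁.clm_comp contDiff_const).add (h₂.clm_comp contDiff_const)

variable [CompleteSpace V]

/-- If `∂ₛ y = K y` and `y(0,·)` solves `∂ₜ y = P y` along `s = 0`, the zero curvature condition
makes `y` solve `∂ₜ y = P y` everywhere. -/
theorem hasDerivAt_snd_of_zeroCurvature (hK : Continuous fun p : ℝ × ℝ => K p.1 p.2)
    (hKt : ∀ s t, HasDerivAt (K s) (Kt s t) t)
    (hKtc : Continuous fun p : ℝ × ℝ => Kt p.1 p.2)
    (hPs : ∀ s t, HasDerivAt (fun x => P x t) (Ps s t) s)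
    (hcurv : ∀ s t v, Kt s t v + K s t (P s t v) = Ps s t v + P s t (K s t v))
    {y : ℝ → ℝ → V} (hys : ∀ s t, HasDerivAt (fun x => y x t) (K s t (y s t)) s)
    (hyt : ∀ t, HasDerivAt (y 0) (P 0 t (y 0 t)) t) (s₀ t₀ : ℝ) :
    HasDerivAt (y s₀) (P s₀ t₀ (y s₀ t₀)) t₀ := by
  obtain ⟨q, hqc, hq0, hq⟩ := exists_continuous_hadamard_quotient hKt hKtc t₀
  have hdiff : Differentiable ℝ (y 0) := fun t => (hyt t).differentiableAt
  have hslope : Continuous (dslope (y 0) t₀) := by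
    rw [← continuousOn_univ, continuousOn_dslope univ_mem]
    exact ⟨hdiff.continuous.continuousOn, hdiff t₀⟩
  have hK₀ : Continuous fun p : ℝ × ℝ => K p.1 t₀ :=
    hK.comp (f := fun p : ℝ × ℝ => (p.1, t₀)) (by fun_prop)
  obtain ⟨w, hwc, hw0, hw⟩ := exists_linearODE_solution (V := V × V)
    (L := fun s t => ((K s t₀).comp (.fst ℝ V V)).prod
      ((K s t).comp (.snd ℝ V V) + (q s t).comp (.fst ℝ V V)))
    (a := fun t => (y 0 t₀, dslope (y 0) t₀ t))
    (by apply continuous_clm_prod <;> fun_prop)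
    (by fun_prop)
  have hw₁ : ∀ s t, HasDerivAt (fun x => (w x t).1) (K s t₀ (w s t).1) s := fun s t =>
    (hw s t).fst
  have hw₂ : ∀ s t, HasDerivAt (fun x => (w x t).2) (K s t (w s t).2 + q s t (w s t).1) s :=
    fun s t => (hw s t).snd
  have hKcont : ∀ t, Continuous fun s => K s t := fun t =>
    hK.comp (f := fun s : ℝ => (s, t)) (by fun_prop)
  have hfst : ∀ s t, (w s t).1 = y s t₀ := fun s t =>
    linearODE_solution_unique (hKcont t₀) (fun x => hw₁ x t) (fun x => hys x t₀)
      (by simp [hw0]) s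
  have hquot : ∀ s t, y s t - y s t₀ = (t - t₀) • (w s t).2 := by
    intro s t
    rw [sub_eq_iff_eq_add']
    refine linearODE_solution_unique (hKcont t) (fun x => hys x t)
      (z := fun x => y x t₀ + (t - t₀) • (w x t).2) (fun x => ?_) ?_ s
    · convert! (hys x t₀).add ((hw₂ x t).const_smul (t - t₀)) using 1
      have := congrArg (fun A : V →L[ℝ] V => A (y x t₀)) (hq x t)
      simp only [_root_.smul_apply, _root_.sub_apply] at this
      rw [smul_add, hfst, this, map_add, map_smul]
      abel
    · simp [hw0, sub_smul_dslope]
  have hval : (w s₀ t₀).2 = P s₀ t₀ (y s₀ t₀) := by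
    have h : ∀ s, HasDerivAt (fun x => (y x t₀, P x t₀ (y x t₀)))
        (K s t₀ (y s t₀), K s t₀ (P s t₀ (y s t₀)) + q s t₀ (y s t₀)) s := fun s => by
      refine (hys s t₀).prodMk ?_
      convert! (hPs s t₀).clm_apply (hys s t₀) using 1
      rw [hq0, add_comm, hcurv]
    have hcont : Continuous fun s => ((K s t₀).comp (.fst ℝ V V)).prod
        ((K s t₀).comp (.snd ℝ V V) + (q s t₀).comp (.fst ℝ V V)) := by
      have := hKcont t₀
      have : Continuous fun s => q s t₀ := hqc.comp (f := fun s : ℝ => (s, t₀)) (by fun_prop)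
      apply continuous_clm_prod <;> fun_prop
    exact congrArg Prod.snd (linearODE_solution_unique hcont (fun s => hw s t₀) h
      (by simp [hw0, (hyt t₀).deriv]) s₀)
  rw [← hval]
  exact hasDerivAt_of_sub_eq_smul (r := fun t => (w s₀ t).2)
    (hwc.comp (f := fun t : ℝ => (s₀, t)) (by fun_prop)).snd.continuousAt (hquot s₀)

/-- Frobenius' theorem for a linear system `∂ₛ y = K y`, `∂ₜ y = P y` of zero curvature. -/
theorem exists_solution_of_zeroCurvature
    (hK : ContDiff ℝ (⊤ : ℕ∞) fun p : ℝ × ℝ => K p.1 p.2)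
    (hP : ContDiff ℝ (⊤ : ℕ∞) fun p : ℝ × ℝ => P p.1 p.2)
    (hKt : ∀ s t, HasDerivAt (K s) (Kt s t) t)
    (hKtc : Continuous fun p : ℝ × ℝ => Kt p.1 p.2)
    (hPs : ∀ s t, HasDerivAt (fun x => P x t) (Ps s t) s)
    (hcurv : ∀ s t v, Kt s t v + K s t (P s t v) = Ps s t v + P s t (K s t v)) (v₀ : V) :
    ∃ y : ℝ → ℝ → V, (ContDiff ℝ (⊤ : ℕ∞) fun p : ℝ × ℝ => y p.1 p.2) ∧ y 0 0 = v₀ ∧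
      (∀ s t, HasDerivAt (fun x => y x t) (K s t (y s t)) s) ∧
      ∀ s t, HasDerivAt (y s) (P s t (y s t)) t := by
  obtain ⟨b, -, hb0, hb⟩ := exists_linearODE_solution (L := fun t _ => P 0 t)
    (a := fun _ => v₀)
    (hP.continuous.comp (f := fun p : ℝ × ℝ => ((0 : ℝ), p.1)) (by fun_prop)) continuous_const
  have hbc : Continuous fun t => b t 0 :=
    continuous_iff_continuousAt.2 fun t => (hb t 0).continuousAt
  obtain ⟨y, hyc, hy0, hys⟩ := exists_linearODE_solution hK.continuous hbc
  have hyb : y 0 = fun t => b t 0 := funext hy0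
  have hyt := hasDerivAt_snd_of_zeroCurvature hK.continuous hKt hKtc hPs hcurv hys
    (fun t => by rw [hyb]; exact hb t 0)
  exact ⟨y, contDiff_of_partial_linear hK hP hyc hys hyt, by rw [hy0, hb0], hys, hyt⟩

end ZeroCurvature

/-- The linear map sending a row vector `v` to the product `v * !![a, b; c, d]`. -/
def rowMul (a b c d : ℝ) : ℝ × ℝ →L[ℝ] ℝ × ℝ :=
  a • (ContinuousLinearMap.fst ℝ ℝ ℝ).prod 0 + b • (0 : ℝ × ℝ →L[ℝ] ℝ).prod (.fst ℝ ℝ ℝ) +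
    c • (ContinuousLinearMap.snd ℝ ℝ ℝ).prod 0 + d • (0 : ℝ × ℝ →L[ℝ] ℝ).prod (.snd ℝ ℝ ℝ)

lemma rowMul_apply (a b c d : ℝ) (v : ℝ × ℝ) :
    rowMul a b c d v = (v.1 * a + v.2 * c, v.1 * b + v.2 * d) := by
  ext <;> simp [rowMul] <;> ring

lemma contDiff_rowMul {X : Type*} [NormedAddCommGroup X] [NormedSpace ℝ X] {n : WithTop ℕ∞}
    {a b c d : X → ℝ} (ha : ContDiff ℝ n a) (hb : ContDiff ℝ n b) (hc : ContDiff ℝ n c)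
    (hd : ContDiff ℝ n d) : ContDiff ℝ n fun x => rowMul (a x) (b x) (c x) (d x) := by
  unfold rowMul
  fun_prop

lemma hasDerivAt_rowMul {a b c d : ℝ → ℝ} {a' b' c' d' x : ℝ} (ha : HasDerivAt a a' x)
    (hb : HasDerivAt b b' x) (hc : HasDerivAt c c' x) (hd : HasDerivAt d d' x) :
    HasDerivAt (fun x => rowMul (a x) (b x) (c x) (d x)) (rowMul a' b' c' d') x :=
  (((ha.smul_const _).add (hb.smul_const _)).add (hc.smul_const _)).add
    (hd.smul_const ((0 : ℝ × ℝ →L[ℝ] ℝ).prod (.snd ℝ ℝ ℝ)))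

lemma contDiff_pdS {f : ℝ → ℝ → ℝ} (hf : ContDiff ℝ (⊤ : ℕ∞) fun p : ℝ × ℝ => f p.1 p.2) :
    ContDiff ℝ (⊤ : ℕ∞) fun p : ℝ × ℝ => pdS f p.1 p.2 := by
  have h : (fun p : ℝ × ℝ => pdS f p.1 p.2) =
      fun p => fderiv ℝ (fun p : ℝ × ℝ => f p.1 p.2) p (1, 0) := by
    funext p
    have hd := (hf.differentiable (by simp) p).hasFDerivAt
    exact (hd.comp_hasDerivAt p.1 ((hasDerivAt_id p.1).prodMk (hasDerivAt_const p.1 p.2))).deriv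
  rw [h]
  exact (hf.fderiv_right (m := (⊤ : ℕ∞)) (by simp)).clm_apply contDiff_const

lemma contDiff_pdT {f : ℝ → ℝ → ℝ} (hf : ContDiff ℝ (⊤ : ℕ∞) fun p : ℝ × ℝ => f p.1 p.2) :
    ContDiff ℝ (⊤ : ℕ∞) fun p : ℝ × ℝ => pdT f p.1 p.2 := by
  have hswap : ContDiff ℝ (⊤ : ℕ∞) fun p : ℝ × ℝ => f p.2 p.1 :=
    hf.comp (contDiff_snd.prodMk contDiff_fst)
  exact (contDiff_pdS (f := fun s t => f t s) hswap).comp (contDiff_snd.prodMk contDiff_fst)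

lemma hasDerivAt_pdS {f : ℝ → ℝ → ℝ} (hf : ContDiff ℝ (⊤ : ℕ∞) fun p : ℝ × ℝ => f p.1 p.2)
    (s t : ℝ) : HasDerivAt (fun x => f x t) (pdS f s t) s :=
  ((hf.comp (contDiff_id.prodMk contDiff_const) : ContDiff ℝ (⊤ : ℕ∞) fun x => f x t).differentiable
    (by simp) s).hasDerivAt

lemma hasDerivAt_pdT {f : ℝ → ℝ → ℝ} (hf : ContDiff ℝ (⊤ : ℕ∞) fun p : ℝ × ℝ => f p.1 p.2)
    (s t : ℝ) : HasDerivAt (f s) (pdT f s t) t :=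
  ((hf.comp (contDiff_const.prodMk contDiff_id) : ContDiff ℝ (⊤ : ℕ∞) fun x => f s x).differentiable
    (by simp) t).hasDerivAt

lemma contDiff_matrix_of {X : Type*} [NormedAddCommGroup X] [NormedSpace ℝ X] {n : WithTop ℕ∞}
    {a b c d : X → ℝ} (ha : ContDiff ℝ n a) (hb : ContDiff ℝ n b) (hc : ContDiff ℝ n c)
    (hd : ContDiff ℝ n d) : ContDiff ℝ n fun x => (!![a x, b x; c x, d x] : M2) := by
  refine contDiff_pi.2 fun i => contDiff_pi.2 fun j => ?_
  fin_cases i <;> fin_cases j <;> assumption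

lemma hasDerivAt_matrix_of {a b c d : ℝ → ℝ} {a' b' c' d' x : ℝ} (ha : HasDerivAt a a' x)
    (hb : HasDerivAt b b' x) (hc : HasDerivAt c c' x) (hd : HasDerivAt d d' x) :
    HasDerivAt (fun x => (!![a x, b x; c x, d x] : M2)) !![a', b'; c', d'] x := by
  refine hasDerivAt_pi.2 fun i => hasDerivAt_pi.2 fun j => ?_
  fin_cases i <;> fin_cases j <;> assumption

/-- Liouville's formula for a trace-free coefficient matrix. -/
lemma det_eq_of_hasDerivAt_mul {E A : ℝ → M2} (hE : ∀ x, HasDerivAt E (E x * A x) x)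
    (hA : ∀ x, (A x).trace = 0) (x y : ℝ) : (E x).det = (E y).det := by
  have hentry : ∀ i j x, HasDerivAt (fun x => E x i j) ((E x * A x) i j) x := fun i j x =>
    hasDerivAt_pi.1 (hasDerivAt_pi.1 (hE x) i) j
  have hdet : ∀ x, HasDerivAt (fun x => (E x).det) 0 x := fun x => by
    simp only [Matrix.det_fin_two]
    convert! ((hentry 0 0 x).mul (hentry 1 1 x)).sub ((hentry 0 1 x).mul (hentry 1 0 x)) using 1
    have htr := hA x
    rw [Matrix.trace_fin_two] at htr
    simp only [Matrix.mul_apply, Fin.sum_univ_two]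
    linear_combination (-(E x 0 0 * E x 1 1) + E x 0 1 * E x 1 0) * htr
  exact is_const_of_deriv_eq_zero (fun x => (hdet x).differentiableAt) (fun x => (hdet x).deriv) x y

/-- For every smooth solution `κ` of the KdV equation and every `λ ∈ ℝ`,
there exists an extended frame of `κ` with spectral parameter `λ`: a smooth map
`E : ℝ² → M₂(ℝ)` with `det E = 1` satisfying `∂ₛE = E·𝒦_λ` and `∂ₜE = E·𝒫_λ`. -/
theorem stmt8 (κ : ℝ → ℝ → ℝ) (hκ : ContDiff ℝ (⊤ : ℕ∞) (fun p : ℝ × ℝ => κ p.1 p.2))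
    (hkdv : ∀ s t : ℝ, pdT κ s t + pdS (pdS (pdS κ)) s t - 6 * κ s t * pdS κ s t = 0)
    (l : ℝ) :
    ∃ E : ℝ → ℝ → M2,
      ContDiff ℝ (⊤ : ℕ∞) (fun p : ℝ × ℝ => E p.1 p.2) ∧
      (∀ s t : ℝ, (E s t).det = 1) ∧
      (∀ s t : ℝ, pdSM E s t = E s t * KLax κ l s t) ∧
      (∀ s t : ℝ, pdTM E s t = E s t * PLax κ l s t) := by
  have hκ₁ := contDiff_pdS hκ
  have hκ₂ := contDiff_pdS hκ₁
  let b : ℝ → ℝ → ℝ := fun s t =>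
    -(pdS (pdS κ) s t) + 2 * (κ s t) ^ 2 - 2 * l * κ s t - 4 * l ^ 2
  have hb : ContDiff ℝ (⊤ : ℕ∞) fun p : ℝ × ℝ => b p.1 p.2 := by fun_prop
  have hbs : ∀ s t, HasDerivAt (fun x => b x t)
      (-pdS (pdS (pdS κ)) s t + 4 * κ s t * pdS κ s t - 2 * l * pdS κ s t) s := fun s t => by
    have h₀ := hasDerivAt_pdS hκ s t
    convert! ((((hasDerivAt_pdS hκ₂ s t).neg.add ((h₀.pow 2).const_mul 2)).sub
      (h₀.const_mul (2 * l))).sub_const (4 * l ^ 2)) using 1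
    ring
  have hrow : ∀ v₀ : ℝ × ℝ, ∃ y : ℝ → ℝ → ℝ × ℝ,
      (ContDiff ℝ (⊤ : ℕ∞) fun p : ℝ × ℝ => y p.1 p.2) ∧ y 0 0 = v₀ ∧
      (∀ s t, HasDerivAt (fun x => y x t) (rowMul 0 (κ s t + l) 1 0 (y s t)) s) ∧
      ∀ s t, HasDerivAt (y s)
        (rowMul (-pdS κ s t) (b s t) (2 * κ s t - 4 * l) (pdS κ s t) (y s t)) t := by
    refine exists_solution_of_zeroCurvature
      (K := fun s t => rowMul 0 (κ s t + l) 1 0)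
      (P := fun s t => rowMul (-pdS κ s t) (b s t) (2 * κ s t - 4 * l) (pdS κ s t))
      (Kt := fun s t => rowMul 0 (pdT κ s t) 0 0)
      (Ps := fun s t => rowMul (-pdS (pdS κ) s t)
        (-pdS (pdS (pdS κ)) s t + 4 * κ s t * pdS κ s t - 2 * l * pdS κ s t)
        (2 * pdS κ s t) (pdS (pdS κ) s t))
      (contDiff_rowMul contDiff_const (by fun_prop) contDiff_const contDiff_const)
      (contDiff_rowMul (by fun_prop) hb (by fun_prop) hκ₁)
      (fun s t => hasDerivAt_rowMul (hasDerivAt_const _ _) ((hasDerivAt_pdT hκ s t).add_const l)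
        (hasDerivAt_const _ _) (hasDerivAt_const _ _))
      (contDiff_rowMul contDiff_const (contDiff_pdT hκ) contDiff_const contDiff_const).continuous
      (fun s t => hasDerivAt_rowMul (hasDerivAt_pdS hκ₁ s t).neg (hbs s t)
        (((hasDerivAt_pdS hκ s t).const_mul 2).sub_const _) (hasDerivAt_pdS hκ₁ s t))
      (fun s t v => ?_)
    simp only [rowMul_apply, b]
    ext
    · simp only [Prod.fst_add]
      ring
    · simp only [Prod.snd_add]
      linear_combination v.1 * hkdv s t
  obtain ⟨y, hy, hy0, hys, hyt⟩ := hrow (1, 0)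
  obtain ⟨z, hz, hz0, hzs, hzt⟩ := hrow (0, 1)
  simp only [rowMul_apply] at hys hyt hzs hzt
  let E : ℝ → ℝ → M2 := fun s t => !![(y s t).1, (y s t).2; (z s t).1, (z s t).2]
  have hEs : ∀ s t, HasDerivAt (fun x => E x t) (E s t * KLax κ l s t) s := fun s t => by
    convert! hasDerivAt_matrix_of (hys s t).fst (hys s t).snd (hzs s t).fst (hzs s t).snd using 1
    simp [E, KLax]
  have hEt : ∀ s t, HasDerivAt (E s) (E s t * PLax κ l s t) t := fun s t => by
    convert! hasDerivAt_matrix_of (hyt s t).fst (hyt s t).snd (hzt s t).fst (hzt s t).snd using 1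
    simp [E, PLax, b]
  refine ⟨E, contDiff_matrix_of hy.fst hy.snd hz.fst hz.snd, fun s t => ?_,
    fun s t => (hEs s t).deriv, fun s t => (hEt s t).deriv⟩
  rw [det_eq_of_hasDerivAt_mul (fun x => hEs x t) (fun x => by simp [KLax, Matrix.trace_fin_two])
    s 0, det_eq_of_hasDerivAt_mul (hEt 0) (fun x => by simp [PLax, Matrix.trace_fin_two]) t 0]
  simp [E, hy0, hz0]
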